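/- Let 𝓗 be a well-structured preconditioner set in dimension d and let η > 0. Let M and M′ be symmetric positive definite d×d real matrices with M′ − M positive semidefinite, and let P, P′ ∈ 𝓗 be positive definite matrices such that P minimizes H ↦ ⟨M, H⁻¹⟩ + η²·Tr(H) and P′ minimizes H ↦ ⟨M′, H⁻¹⟩ + η²·Tr(H) over positive definite H ∈ 𝓗. Then P′ − P ∈ 𝓗; in particular P′ − P is positive semidefinite. -/

import Mathlib

open Matrix

/-- A set of real `d × d` matrices closed under scalar multiplication, addition and
matrix multiplication, containing the identity. -/
def IsMatrixSubalgebra {d : ℕ} (K : Set (Matrix (Fin d) (Fin d) ℝ)) : Prop :=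
  (∀ (c : ℝ), ∀ A ∈ K, c • A ∈ K) ∧ (∀ A ∈ K, ∀ B ∈ K, A + B ∈ K) ∧
    (∀ A ∈ K, ∀ B ∈ K, A * B ∈ K) ∧ (1 : Matrix (Fin d) (Fin d) ℝ) ∈ K

/-- A well-structured preconditioner set: `𝓗 = 𝒦 ∩ S₊^d` for a matrix subalgebra `𝒦`. -/
def WellStructured {d : ℕ} (𝓗 : Set (Matrix (Fin d) (Fin d) ℝ)) : Prop :=
  ∃ K : Set (Matrix (Fin d) (Fin d) ℝ),
    IsMatrixSubalgebra K ∧ 𝓗 = K ∩ {M | M.PosSemidef}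

/-- `⟨A,B⟩ := Tr(Aᵀ B)` for square real matrices. -/
noncomputable def minner {n : Type*} [Fintype n] (A B : Matrix n n ℝ) : ℝ := (Aᵀ * B).trace

/-- The subalgebra bundling a set satisfying `IsMatrixSubalgebra`. -/
def IsMatrixSubalgebra.toSubalgebra {d : ℕ} {K : Set (Matrix (Fin d) (Fin d) ℝ)}
    (hK : IsMatrixSubalgebra K) : Subalgebra ℝ (Matrix (Fin d) (Fin d) ℝ) where
  carrier := K
  mul_mem' {a b} ha hb := hK.2.2.1 a ha b hb
  add_mem' {a b} ha hb := hK.2.1 a ha b hb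
  algebraMap_mem' r := by
    rw [Algebra.algebraMap_eq_smul_one]
    exact hK.1 r 1 hK.2.2.2

namespace Matrix

variable {n : Type*} [Fintype n] [DecidableEq n]

/-- On a real symmetric matrix, the functional calculus is polynomial. -/
lemma IsHermitian.cfc_mem_subalgebra {A : Matrix n n ℝ} (hA : A.IsHermitian)
    {S : Subalgebra ℝ (Matrix n n ℝ)} (hS : A ∈ S) (f : ℝ → ℝ) : cfc f A ∈ S := by
  classical
  let s : Finset ℝ := A.finite_real_spectrum.toFinset
  have hf : (spectrum ℝ A).EqOn f (Lagrange.interpolate s id f).eval := fun x hx ↦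
    (Lagrange.eval_interpolate_at_node f (Set.injOn_id _)
      (A.finite_real_spectrum.mem_toFinset.2 hx)).symm
  rw [cfc_congr hf, cfc_polynomial _ _ hA.isSelfAdjoint]
  exact Algebra.adjoin_le (Set.singleton_subset_iff.2 hS)
    (Polynomial.aeval_mem_adjoin_singleton ℝ A)

/-- A subalgebra contains the inverses of its positive definite elements. -/
lemma PosDef.inv_mem_subalgebra {A : Matrix n n ℝ} (hA : A.PosDef)
    {S : Subalgebra ℝ (Matrix n n ℝ)} (hS : A ∈ S) : A⁻¹ ∈ S := by
  have hfin : ∀ f : ℝ → ℝ, ContinuousOn f (spectrum ℝ A) := fun f ↦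
    A.finite_real_spectrum.continuousOn f
  have hsa := hA.isHermitian.isSelfAdjoint
  have hinv : A * cfc (fun x : ℝ ↦ x⁻¹) A = 1 := by
    calc A * cfc (fun x : ℝ ↦ x⁻¹) A
        = cfc (fun x : ℝ ↦ x) A * cfc (fun x : ℝ ↦ x⁻¹) A := by rw [cfc_id' ℝ A hsa]
      _ = cfc (fun x : ℝ ↦ x * x⁻¹) A := (cfc_mul _ _ A (hfin _) (hfin _)).symm
      _ = cfc (fun _ : ℝ ↦ 1) A := cfc_congr fun x hx ↦ mul_inv_cancel₀ <| by
          rintro rfl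
          exact spectrum.zero_notMem ℝ hA.isUnit hx
      _ = 1 := cfc_const_one ℝ A hsa
  rw [inv_eq_right_inv hinv]
  exact hA.isHermitian.cfc_mem_subalgebra hS _

/-- The one-sided first-order condition at `t = 0` for `t ↦ c * t + Tr (C (A + t B)⁻¹)`. -/
lemma PosDef.trace_mul_inv_mul_mul_inv_le {A B C : Matrix n n ℝ} (hA : A.PosDef)
    (hB : B.PosSemidef) {c : ℝ}
    (h : ∀ t : ℝ, 0 < t → (C * A⁻¹).trace ≤ c * t + (C * (A + t • B)⁻¹).trace) :
    (C * (A⁻¹ * B * A⁻¹)).trace ≤ c := by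
  have hlim : Filter.Tendsto (fun t : ℝ ↦ (C * (A⁻¹ * B * (A + t • B)⁻¹)).trace)
      (nhdsWithin 0 (Set.Ioi 0)) (nhds (C * (A⁻¹ * B * A⁻¹)).trace) := by
    have hdet : A.det ≠ 0 := hA.det_pos.ne'
    have hinv : ContinuousAt (fun t : ℝ ↦ (A + t • B)⁻¹) 0 := by
      have hcont : ContinuousAt Inv.inv (A + (0 : ℝ) • B) := by
        refine continuousAt_matrix_inv _ ?_
        simpa [Ring.inverse_eq_inv'] using continuousAt_inv₀ hdet
      exact ContinuousAt.comp (f := fun t : ℝ ↦ A + t • B) hcont (by fun_prop)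
    have hcont : ContinuousAt (fun t : ℝ ↦ (C * (A⁻¹ * B * (A + t • B)⁻¹)).trace) 0 := by
      have htr : Continuous fun X : Matrix n n ℝ ↦ (C * (A⁻¹ * B * X)).trace := by fun_prop
      exact ContinuousAt.comp (f := fun t : ℝ ↦ (A + t • B)⁻¹) htr.continuousAt hinv
    simpa using hcont.tendsto.mono_left nhdsWithin_le_nhds
  refine le_of_tendsto hlim (eventually_nhdsWithin_of_forall fun t ht ↦ ?_)
  have ht : 0 < t := ht
  have hAt : (A + t • B).PosDef := hA.add_posSemidef (hB.smul ht.le)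
  have hres : A⁻¹ - (A + t • B)⁻¹ = t • (A⁻¹ * B * (A + t • B)⁻¹) := by
    calc A⁻¹ - (A + t • B)⁻¹
        = A⁻¹ * ((A + t • B) * (A + t • B)⁻¹) - (A⁻¹ * A) * (A + t • B)⁻¹ := by
          rw [mul_nonsing_inv _ hAt.det_pos.ne'.isUnit, nonsing_inv_mul _ hA.det_pos.ne'.isUnit,
            mul_one, one_mul]
      _ = t • (A⁻¹ * B * (A + t • B)⁻¹) := by
          rw [add_mul, mul_add, mul_assoc A⁻¹ A, add_sub_cancel_left, smul_mul, Matrix.mul_smul,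
            mul_assoc]
  have hdiff : (C * A⁻¹).trace - (C * (A + t • B)⁻¹).trace
      = t * (C * (A⁻¹ * B * (A + t • B)⁻¹)).trace := by
    rw [← trace_sub, ← mul_sub, hres, Matrix.mul_smul, trace_smul, smul_eq_mul]
  have := h t ht
  exact le_of_mul_le_mul_left (by linarith) ht

open scoped MatrixOrder Matrix.Norms.L2Operator in
/-- The trace of a product of two positive semidefinite matrices is nonnegative. -/
lemma PosSemidef.trace_mul_nonneg {A B : Matrix n n ℝ} (hA : A.PosSemidef)
    (hB : B.PosSemidef) : 0 ≤ (A * B).trace := by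
  obtain ⟨Y, rfl⟩ := CStarAlgebra.nonneg_iff_eq_star_mul_self.1 hB.nonneg
  rw [← mul_assoc, trace_mul_comm, ← mul_assoc]
  exact (hA.mul_mul_conjTranspose_same Y).trace_nonneg

/-- For positive definite matrices, testing `Q² - P²` only against positive semidefinite members of a
subalgebra containing both is enough to conclude `P ≤ Q`. -/
lemma posSemidef_sub_of_trace_le {P Q : Matrix n n ℝ} (hP : P.PosDef) (hQ : Q.PosDef)
    {S : Subalgebra ℝ (Matrix n n ℝ)} (hPS : P ∈ S) (hQS : Q ∈ S)
    (h : ∀ X ∈ S, X.PosSemidef → (P * X * P).trace ≤ (Q * X * Q).trace) :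
    (Q - P).PosSemidef := by
  have hD : (Q - P).IsHermitian := hQ.isHermitian.sub hP.isHermitian
  set D := Q - P with hDdef
  have hsa := hD.isSelfAdjoint
  have hfin : ∀ f : ℝ → ℝ, ContinuousOn f (spectrum ℝ D) := fun f ↦
    D.finite_real_spectrum.continuousOn f
  have hsq : ∀ f : ℝ → ℝ, (∀ x, 0 ≤ f x) → (cfc f D).PosSemidef := fun f hf ↦ by
    have heq : cfc f D = (cfc (fun x ↦ √(f x)) D)ᴴ * cfc (fun x ↦ √(f x)) D := by
      rw [(cfc_predicate (fun x ↦ √(f x)) D : IsSelfAdjoint _).isHermitian.eq,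
        ← cfc_mul _ _ D (hfin _) (hfin _)]
      exact cfc_congr fun x _ ↦ (Real.mul_self_sqrt (hf x)).symm
    rw [heq]
    exact posSemidef_conjTranspose_mul_self _
  set X := cfc (fun x : ℝ ↦ max (-x) 0) D with hX
  have hXpos : X.PosSemidef := hsq _ fun x ↦ le_max_right _ _
  have hid : cfc (fun x : ℝ ↦ x) D = D := cfc_id' ℝ D hsa
  have hpart : ∀ x : ℝ, max (-x) 0 * x = -(max (-x) 0 * max (-x) 0) := fun x ↦ by
    rcases le_total (-x) 0 with hx | hx
    · simp [max_eq_right hx]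
    · simp [max_eq_left hx]
  have hXD : X * D = -(X * X) := by
    calc X * D = X * cfc (fun x : ℝ ↦ x) D := by rw [hid]
      _ = cfc (fun x : ℝ ↦ -(max (-x) 0 * max (-x) 0)) D := by
          rw [hX, ← cfc_mul _ _ D (hfin _) (hfin _)]
          exact cfc_congr fun x _ ↦ hpart x
      _ = -(X * X) := by rw [cfc_neg, cfc_mul _ _ D (hfin _) (hfin _)]
  have hDX : D * X = -(X * X) := by
    have := congrArg conjTranspose hXD
    rwa [conjTranspose_mul, conjTranspose_neg, conjTranspose_mul, hXpos.isHermitian.eq,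
      hD.eq] at this
  have htrace : (Q * X * Q).trace - (P * X * P).trace = -(X * (P + Q) * X).trace := by
    have hexp : (Q * X * Q).trace - (P * X * P).trace
        = ((D * X) * Q).trace + ((X * D) * P).trace := by
      have hcycle : (P * X * Q).trace = (X * Q * P).trace := by
        rw [mul_assoc, trace_mul_comm]
      have hcycle' : (P * X * P).trace = (X * P * P).trace := by
        rw [mul_assoc, trace_mul_comm]
      rw [hDdef]
      simp only [sub_mul, mul_sub, trace_sub, hcycle, hcycle']
      ring
    rw [hexp, hDX, hXD, mul_assoc X (P + Q) X, trace_mul_comm X, mul_assoc (P + Q),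
      trace_mul_comm (P + Q), mul_add, trace_add]
    simp only [neg_mul, trace_neg]
    ring
  have hS := h X (hD.cfc_mem_subalgebra (S.sub_mem hQS hPS) _) hXpos
  have hPQ : (P + Q).PosDef := hP.add hQ
  have hpsd : (X * (P + Q) * X).PosSemidef := by
    have := hPQ.posSemidef.mul_mul_conjTranspose_same X
    rwa [hXpos.isHermitian.eq] at this
  have hzero : X * (P + Q) * X = 0 :=
    hpsd.trace_eq_zero_iff.1 (le_antisymm (by linarith) hpsd.trace_nonneg)
  have hX0 : X = 0 := by
    by_contra hne
    obtain ⟨v, hv⟩ : ∃ v, X *ᵥ v ≠ 0 := by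
      by_contra! hall
      exact hne (ext_of_mulVec_single fun i ↦ by rw [hall, zero_mulVec])
    have hpos := hPQ.dotProduct_mulVec_pos hv
    have hval : star (X *ᵥ v) ⬝ᵥ (P + Q) *ᵥ X *ᵥ v = star v ⬝ᵥ (X * (P + Q) * X) *ᵥ v := by
      rw [star_mulVec, hXpos.isHermitian.eq, ← dotProduct_mulVec, mulVec_mulVec, mulVec_mulVec,
        mul_assoc]
    rw [hval, hzero, zero_mulVec, dotProduct_zero] at hpos
    exact hpos.false
  have hpos : D = cfc (fun x : ℝ ↦ max x 0) D := by
    calc D = cfc (fun x : ℝ ↦ x) D + X := by rw [hid, hX0, add_zero]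
      _ = cfc (fun x : ℝ ↦ x + max (-x) 0) D := (cfc_add D _ _ (hfin _) (hfin _)).symm
      _ = cfc (fun x : ℝ ↦ max x 0) D := cfc_congr fun x _ ↦ by
          simp [← max_add_add_left, max_comm]
  rw [hpos]
  exact hsq _ fun x ↦ le_max_right _ _

end Matrix

theorem stmt_4 {d : ℕ} (𝓗 : Set (Matrix (Fin d) (Fin d) ℝ)) (h𝓗 : WellStructured 𝓗)
    (η : ℝ) (hη : 0 < η) (M M' : Matrix (Fin d) (Fin d) ℝ)
    (hM : M.PosDef) (hM' : M'.PosDef) (hle : (M' - M).PosSemidef)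
    (P P' : Matrix (Fin d) (Fin d) ℝ)
    (hP𝓗 : P ∈ 𝓗) (hP : P.PosDef)
    (hPmin : ∀ H ∈ 𝓗, H.PosDef →
      minner M P⁻¹ + η ^ 2 * P.trace ≤ minner M H⁻¹ + η ^ 2 * H.trace)
    (hP'𝓗 : P' ∈ 𝓗) (hP' : P'.PosDef)
    (hP'min : ∀ H ∈ 𝓗, H.PosDef →
      minner M' P'⁻¹ + η ^ 2 * P'.trace ≤ minner M' H⁻¹ + η ^ 2 * H.trace) :
    P' - P ∈ 𝓗 ∧ (P' - P).PosSemidef := by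
  obtain ⟨K, hK, rfl⟩ := h𝓗
  have hPS : P ∈ hK.toSubalgebra := hP𝓗.1
  have hP'S : P' ∈ hK.toSubalgebra := hP'𝓗.1
  have hMt : Mᵀ = M := by rw [← conjTranspose_eq_transpose_of_trivial, hM.isHermitian.eq]
  have hM't : M'ᵀ = M' := by rw [← conjTranspose_eq_transpose_of_trivial, hM'.isHermitian.eq]
  simp only [minner, hMt, hM't] at hPmin hP'min
  have hη2 : 0 < η ^ 2 := by positivity
  have key : (P' - P).PosSemidef := by
    refine posSemidef_sub_of_trace_le hP hP' hPS hP'S fun X hXS hX ↦ ?_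
    have hlower : η ^ 2 * (P * X * P).trace ≤ (M * X).trace := by
      have hfoc := hP.inv.trace_mul_inv_mul_mul_inv_le (C := η ^ 2 • 1) (c := (M * X).trace) hX
        fun t ht ↦ by
          have hpd : (P⁻¹ + t • X).PosDef := hP.inv.add_posSemidef (hX.smul ht.le)
          have hmem : (P⁻¹ + t • X)⁻¹ ∈ hK.toSubalgebra := hpd.inv_mem_subalgebra <|
            Subalgebra.add_mem _ (hP.inv_mem_subalgebra hPS) (Subalgebra.smul_mem _ hXS t)
          have hmin := hPmin _ ⟨hmem, hpd.inv.posSemidef⟩ hpd.inv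
          rw [nonsing_inv_nonsing_inv _ hpd.det_pos.ne'.isUnit, mul_add, trace_add, Matrix.mul_smul,
            trace_smul, smul_eq_mul] at hmin
          rw [nonsing_inv_nonsing_inv _ hP.det_pos.ne'.isUnit]
          simp only [smul_mul, one_mul, trace_smul, smul_eq_mul]
          linarith
      rw [nonsing_inv_nonsing_inv _ hP.det_pos.ne'.isUnit] at hfoc
      simpa using hfoc
    have hupper : (M' * X).trace ≤ η ^ 2 * (P' * X * P').trace := by
      have hB : (P' * X * P').PosSemidef := by
        have := hX.mul_mul_conjTranspose_same P'
        rwa [hP'.isHermitian.eq] at this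
      have hBS : P' * X * P' ∈ hK.toSubalgebra :=
        Subalgebra.mul_mem _ (Subalgebra.mul_mem _ hP'S hXS) hP'S
      have hfoc := hP'.trace_mul_inv_mul_mul_inv_le (C := M')
        (c := η ^ 2 * (P' * X * P').trace) hB fun t ht ↦ by
          have hpd : (P' + t • (P' * X * P')).PosDef := hP'.add_posSemidef (hB.smul ht.le)
          have hmem : P' + t • (P' * X * P') ∈ hK.toSubalgebra :=
            Subalgebra.add_mem _ hP'S (Subalgebra.smul_mem _ hBS t)
          have hmin := hP'min _ ⟨hmem, hpd.posSemidef⟩ hpd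
          rw [trace_add, trace_smul, smul_eq_mul] at hmin
          linarith
      have hcancel : P'⁻¹ * (P' * X * P') * P'⁻¹ = X := by
        have hu := hP'.det_pos.ne'.isUnit
        rw [mul_assoc P', nonsing_inv_mul_cancel_left _ _ hu, mul_nonsing_inv_cancel_right _ _ hu]
      rwa [hcancel] at hfoc
    have hmono : 0 ≤ ((M' - M) * X).trace := hle.trace_mul_nonneg hX
    rw [sub_mul, trace_sub] at hmono
    exact le_of_mul_le_mul_left (by linarith) hη2
  exact ⟨⟨hK.toSubalgebra.sub_mem hP'S hPS, key⟩, key⟩
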